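/- Let (a,b) ∈ ℝ/ℤ × [0,1]. If p ∈ ℝ/ℤ is a periodic point of f_{a,b} of exact period n, then φ_{a,b}(p) is a periodic point of the doubling map D of exact period n. -/

import Mathlib

open Set Filter Topology

noncomputable section

/-- Representative of a point of the circle in `[0,1)`. -/
noncomputable def rep (z : UnitAddCircle) : ℝ := (AddCircle.equivIco 1 0 z).val

/-- The straight sine map on `[0,1)`. -/
noncomputable def Sfun (t : ℝ) : ℝ := if t ≤ 1/2 then 4*t - 1 else -4*t + 3

/-- The piecewise linear perturbation of the doubling map. -/
noncomputable def plpdm (a : UnitAddCircle) (b : ℝ) (z : UnitAddCircle) : UnitAddCircle :=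
  ((2 * rep z + (b/2) * Sfun (rep z) : ℝ) : UnitAddCircle) + a

/-- The doubling map. -/
def Dbl (z : UnitAddCircle) : UnitAddCircle := z + z

/-- `x` is an attracting periodic point of `f` of exact period `n`. -/
def IsAttractingPeriodicPt (f : UnitAddCircle → UnitAddCircle) (n : ℕ)
    (x : UnitAddCircle) : Prop :=
  0 < n ∧ f^[n] x = x ∧ (∀ m, 0 < m → m < n → f^[m] x ≠ x) ∧
  ∃ U : Set UnitAddCircle, IsOpen U ∧ IsConnected U ∧ x ∈ U ∧ f^[n] '' U ⊆ U ∧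
    ∀ y ∈ U, Tendsto (fun k => f^[n*k] y) atTop (nhds x)

/-- Forward orbit of `x` under `f`. -/
def orbitSet (f : UnitAddCircle → UnitAddCircle) (x : UnitAddCircle) : Set UnitAddCircle :=
  {y | ∃ i, f^[i] x = y}

/-- Basin of attraction of the set `O`. -/
def basin (f : UnitAddCircle → UnitAddCircle) (O : Set UnitAddCircle) : Set UnitAddCircle :=
  {y | Tendsto (fun k => Metric.infDist (f^[k] y) O) atTop (nhds 0)}

/-- Immediate basin of attraction of the orbit `O`. -/
def immBasin (f : UnitAddCircle → UnitAddCircle) (O : Set UnitAddCircle) :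
    Set UnitAddCircle :=
  ⋃ z ∈ O, connectedComponentIn (basin f O) z

/-- The hyperbolic set `H`. -/
def hypSet : Set (UnitAddCircle × ℝ) :=
  {q | q.2 ∈ Set.Ico (0:ℝ) 1 ∧ ∃ n x, IsAttractingPeriodicPt (plpdm q.1 q.2) n x}

/-- The lift `F_{a,b}` of `f_{a,b}`, normalized so that `F_{a,b}(0) ∈ [0,1)`. -/
noncomputable def liftF (a : UnitAddCircle) (b : ℝ) (x : ℝ) : ℝ :=
  (2 * Int.fract x + rep a + (b/2) * Sfun (Int.fract x)
    + (if rep a - b/2 < 0 then 1 else 0)) + 2 * (⌊x⌋ : ℝ)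

/-- `Φ_{a,b}`, the limit of `F_{a,b}^n(x)/2^n`. -/
noncomputable def Phi (a : UnitAddCircle) (b : ℝ) (x : ℝ) : ℝ :=
  limUnder atTop (fun n : ℕ => (liftF a b)^[n] x / 2 ^ n)

/-- The semiconjugacy `φ_{a,b}` induced by `Φ_{a,b}`. -/
noncomputable def phiMap (a : UnitAddCircle) (b : ℝ) (z : UnitAddCircle) : UnitAddCircle :=
  ((Phi a b (rep z) : ℝ) : UnitAddCircle)

/-- The arc `I₊ = [0,1/2]` of the circle. -/
def Iplus : Set UnitAddCircle := (fun t : ℝ => (t : UnitAddCircle)) '' Set.Icc 0 (1/2)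

/-- The arc `I₋ = [1/2,1]` of the circle. -/
def Iminus : Set UnitAddCircle := (fun t : ℝ => (t : UnitAddCircle)) '' Set.Icc (1/2) 1

/-- The orbit of `x` (of period `p`) avoids `0`, `1/2` and has slope itinerary `σ`,
where `σ j = true` encodes the symbol `−` and `σ j = false` encodes `+`. -/
def HasItinerary (f : UnitAddCircle → UnitAddCircle) (p : ℕ) (x : UnitAddCircle)
    (σ : Fin p → Bool) : Prop :=
  (∀ j : Fin p, f^[(j : ℕ)] x ≠ (0 : UnitAddCircle) ∧
      f^[(j : ℕ)] x ≠ (((1:ℝ)/2 : ℝ) : UnitAddCircle)) ∧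
  ∀ j : Fin p, (σ j = true → f^[(j : ℕ)] x ∈ Iminus) ∧ (σ j = false → f^[(j : ℕ)] x ∈ Iplus)

/-- The set `P_σ` of parameters whose attracting orbit has slope itinerary `σ`. -/
def paramSet (p : ℕ) (σ : Fin p → Bool) : Set (UnitAddCircle × ℝ) :=
  {q | q.2 ∈ Set.Ico (0:ℝ) 1 ∧ ∃ x, IsAttractingPeriodicPt (plpdm q.1 q.2) p x ∧
       HasItinerary (plpdm q.1 q.2) p x σ}

/-- `S` is a tongue: its closure meets `ℝ/ℤ × {1}` in a nondegenerate interval. -/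
def IsTongue (S : Set (UnitAddCircle × ℝ)) : Prop :=
  ∃ u v : ℝ, u < v ∧ ∀ t ∈ Set.Icc u v, (((t : ℝ) : UnitAddCircle), (1:ℝ)) ∈ closure S

end


theorem coe_rep (z : UnitAddCircle) : (rep z : UnitAddCircle) = z :=
  (AddCircle.equivIco 1 0).symm_apply_apply z

theorem rep_mem (z : UnitAddCircle) : rep z ∈ Set.Ico (0 : ℝ) 1 := by
  simpa [rep] using (AddCircle.equivIco 1 0 z).2

theorem rep_coe (x : ℝ) : rep (x : UnitAddCircle) = Int.fract x := by
  simp [rep]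

theorem coe_int (k : ℤ) : ((k : ℝ) : UnitAddCircle) = 0 :=
  (AddCircle.coe_eq_zero_iff 1).2 ⟨k, by simp⟩

theorem exists_int_of_coe_eq {x y : ℝ} (h : (x : UnitAddCircle) = y) :
    ∃ k : ℤ, x = y + k := by
  have h' : ((x - y : ℝ) : UnitAddCircle) = 0 := by
    rw [AddCircle.coe_sub, h, sub_self]
  obtain ⟨k, hk⟩ := (AddCircle.coe_eq_zero_iff 1).1 h'
  refine ⟨k, ?_⟩
  simp only [zsmul_eq_mul, mul_one] at hk
  linarith

theorem abs_Sfun_le {t : ℝ} (ht : t ∈ Set.Icc (0 : ℝ) 1) : |Sfun t| ≤ 1 := by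
  obtain ⟨h0, h1⟩ := ht
  rw [abs_le]
  unfold Sfun
  split_ifs <;> constructor <;> linarith

theorem two_mul_add_Sfun_mono {b : ℝ} (hb : b ∈ Set.Icc (0 : ℝ) 1) {t u : ℝ} (htu : t ≤ u) :
    2 * t + b / 2 * Sfun t ≤ 2 * u + b / 2 * Sfun u := by
  obtain ⟨h0, h1⟩ := hb
  unfold Sfun
  split_ifs with h2 h3 h3
  · nlinarith
  · push Not at h3
    nlinarith [mul_nonneg h0 (sub_nonneg.2 h2), mul_nonneg (sub_nonneg.2 h1) (sub_nonneg.2 h3.le)]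
  · linarith
  · nlinarith

theorem liftF_add_int (a : UnitAddCircle) (b x : ℝ) (k : ℤ) :
    liftF a b (x + k) = liftF a b x + 2 * k := by
  simp only [liftF, Int.fract_add_intCast, Int.floor_add_intCast]
  push_cast
  ring

theorem monotone_liftF (a : UnitAddCircle) {b : ℝ} (hb : b ∈ Set.Icc (0 : ℝ) 1) :
    Monotone (liftF a b) := by
  intro x y hxy
  rcases (Int.floor_le_floor hxy).eq_or_lt with h | h
  · have hf : Int.fract x ≤ Int.fract y := by
      simp only [Int.fract, h]
      linarith
    have := two_mul_add_Sfun_mono hb hf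
    simp only [liftF, h]
    linarith
  · have h1 : (⌊x⌋ : ℝ) + 1 ≤ ⌊y⌋ := by exact_mod_cast h
    have h2 := two_mul_add_Sfun_mono hb (Int.fract_lt_one x).le
    have h3 := two_mul_add_Sfun_mono hb (Int.fract_nonneg y)
    have h4 : Sfun 1 = -1 := by norm_num [Sfun]
    have h5 : Sfun 0 = -1 := by norm_num [Sfun]
    rw [h4] at h2
    rw [h5] at h3
    simp only [liftF]
    linarith

theorem abs_liftF_sub_le (a : UnitAddCircle) {b : ℝ} (hb : b ∈ Set.Icc (0 : ℝ) 1) (x : ℝ) :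
    |liftF a b x - 2 * x| ≤ 3 := by
  obtain ⟨h0, h1⟩ := hb
  obtain ⟨ha0, ha1⟩ := rep_mem a
  have hS := abs_le.1 (abs_Sfun_le ⟨Int.fract_nonneg x, (Int.fract_lt_one x).le⟩)
  have hx := Int.fract_add_floor x
  have hbS : |b / 2 * Sfun (Int.fract x)| ≤ 1 := by
    rw [abs_le]
    constructor <;> nlinarith
  rw [abs_le] at hbS ⊢
  unfold liftF
  split_ifs <;> constructor <;> linarith

theorem coe_liftF (a : UnitAddCircle) (b x : ℝ) :
    (liftF a b x : UnitAddCircle) = plpdm a b x := by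
  have h : liftF a b x = (2 * Int.fract x + b / 2 * Sfun (Int.fract x)) + rep a +
      (((if rep a - b / 2 < 0 then 1 else 0) + 2 * ⌊x⌋ : ℤ) : ℝ) := by
    unfold liftF
    split_ifs <;> push_cast <;> ring
  rw [h, AddCircle.coe_add, coe_int, add_zero, AddCircle.coe_add, coe_rep, plpdm, rep_coe]

theorem coe_liftF_iterate (a : UnitAddCircle) (b : ℝ) (m : ℕ) (x : ℝ) :
    ((liftF a b)^[m] x : UnitAddCircle) = (plpdm a b)^[m] x :=
  (Function.Semiconj.iterate_right (f := fun t : ℝ => (t : UnitAddCircle))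
    (coe_liftF a b) m) x

theorem liftF_iterate_add_int (a : UnitAddCircle) (b : ℝ) (m : ℕ) (x : ℝ) (k : ℤ) :
    (liftF a b)^[m] (x + k) = (liftF a b)^[m] x + 2 ^ m * k := by
  induction m with
  | zero => simp
  | succ m ih =>
    have h := liftF_add_int a b ((liftF a b)^[m] x) (2 ^ m * k)
    push_cast at h
    rw [Function.iterate_succ_apply', ih, h, Function.iterate_succ_apply']
    ring

theorem tendsto_Phi (a : UnitAddCircle) {b : ℝ} (hb : b ∈ Set.Icc (0 : ℝ) 1) (x : ℝ) :
    Tendsto (fun n : ℕ => (liftF a b)^[n] x / 2 ^ n) atTop (𝓝 (Phi a b x)) := by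
  refine (cauchySeq_of_le_geometric_two (C := 3) fun n => ?_).tendsto_limUnder
  have h := abs_liftF_sub_le a hb ((liftF a b)^[n] x)
  rw [Function.iterate_succ_apply', dist_comm, Real.dist_eq]
  have e : liftF a b ((liftF a b)^[n] x) / 2 ^ (n + 1) - (liftF a b)^[n] x / 2 ^ n =
      (liftF a b ((liftF a b)^[n] x) - 2 * (liftF a b)^[n] x) / 2 / 2 ^ n := by
    rw [pow_succ]
    field_simp
  rw [e, abs_div, abs_div, abs_of_pos (by positivity : (0 : ℝ) < 2 ^ n), abs_two]
  gcongr

theorem Phi_liftF (a : UnitAddCircle) {b : ℝ} (hb : b ∈ Set.Icc (0 : ℝ) 1) (x : ℝ) :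
    Phi a b (liftF a b x) = 2 * Phi a b x := by
  refine tendsto_nhds_unique (tendsto_Phi a hb (liftF a b x)) ?_
  refine (((tendsto_Phi a hb x).comp (tendsto_add_atTop_nat 1)).const_mul 2).congr fun n => ?_
  simp only [Function.comp_apply, Function.iterate_succ_apply, pow_succ]
  field_simp

theorem Phi_liftF_iterate (a : UnitAddCircle) {b : ℝ} (hb : b ∈ Set.Icc (0 : ℝ) 1) (m : ℕ)
    (x : ℝ) : Phi a b ((liftF a b)^[m] x) = 2 ^ m * Phi a b x := by
  induction m with
  | zero => simp
  | succ m ih => rw [Function.iterate_succ_apply', Phi_liftF a hb, ih, pow_succ]; ring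

theorem Phi_add_int (a : UnitAddCircle) {b : ℝ} (hb : b ∈ Set.Icc (0 : ℝ) 1) (x : ℝ) (k : ℤ) :
    Phi a b (x + k) = Phi a b x + k := by
  refine tendsto_nhds_unique (tendsto_Phi a hb (x + k)) ?_
  refine ((tendsto_Phi a hb x).add_const (k : ℝ)).congr fun n => ?_
  rw [liftF_iterate_add_int]
  field_simp

theorem phiMap_coe (a : UnitAddCircle) {b : ℝ} (hb : b ∈ Set.Icc (0 : ℝ) 1) (x : ℝ) :
    phiMap a b x = (Phi a b x : UnitAddCircle) := by
  conv_rhs => rw [← Int.fract_add_floor x, Phi_add_int a hb, AddCircle.coe_add, coe_int, add_zero]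
  rw [phiMap, rep_coe]

theorem semiconj_phiMap (a : UnitAddCircle) {b : ℝ} (hb : b ∈ Set.Icc (0 : ℝ) 1) :
    Function.Semiconj (phiMap a b) (plpdm a b) Dbl := by
  intro z
  rw [← coe_rep z, ← coe_liftF, phiMap_coe a hb, phiMap_coe a hb, Phi_liftF a hb, Dbl, two_mul,
    AddCircle.coe_add]

theorem Monotone.eq_of_iterate_eq {α : Type*} [LinearOrder α] {g : α → α} (hg : Monotone g)
    {n : ℕ} (hn : 0 < n) {x : α} (h : g^[n] x = x) : g x = x := by
  rcases lt_trichotomy (g x) x with hlt | heq | hgt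
  · have := hg.antitone_iterate_of_map_le hlt.le (Nat.succ_le_of_lt hn)
    simp only [h, Nat.succ_eq_add_one, zero_add, Function.iterate_one] at this
    exact absurd hlt this.not_gt
  · exact heq
  · have := hg.monotone_iterate_of_le_map hgt.le (Nat.succ_le_of_lt hn)
    simp only [h, Nat.succ_eq_add_one, zero_add, Function.iterate_one] at this
    exact absurd hgt this.not_gt

theorem plpdm_iterate_eq_of_phiMap_eq (a : UnitAddCircle) {b : ℝ} (hb : b ∈ Set.Icc (0 : ℝ) 1)
    {n : ℕ} (hn : 0 < n) {p : UnitAddCircle} (hp : (plpdm a b)^[n] p = p) {m : ℕ}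
    (h : phiMap a b ((plpdm a b)^[m] p) = phiMap a b p) : (plpdm a b)^[m] p = p := by
  obtain ⟨x, rfl⟩ : ∃ x : ℝ, (x : UnitAddCircle) = p := ⟨rep p, coe_rep p⟩
  rw [← coe_liftF_iterate, phiMap_coe a hb, phiMap_coe a hb] at h
  obtain ⟨k, hk⟩ := exists_int_of_coe_eq h
  rw [Phi_liftF_iterate a hb] at hk
  set g : ℝ → ℝ := fun y => (liftF a b)^[m] y + ((-k : ℤ) : ℝ) with hg
  have hmono : Monotone g := ((monotone_liftF a hb).iterate m).add_const _
  have hcoe (y : ℝ) : (g y : UnitAddCircle) = (plpdm a b)^[m] y := by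
    rw [hg, AddCircle.coe_add, coe_int, add_zero, coe_liftF_iterate]
  have hPhi (j : ℕ) : Phi a b (g^[j] x) = Phi a b x := by
    induction j with
    | zero => rfl
    | succ j ih =>
      rw [Function.iterate_succ_apply', hg, Phi_add_int a hb, Phi_liftF_iterate a hb, ← hg, ih, hk]
      push_cast
      ring
  have hfix : (g^[n] x : UnitAddCircle) = x := by
    have := (Function.Semiconj.iterate_right (f := fun t : ℝ => (t : UnitAddCircle)) hcoe n) x
    beta_reduce at this
    rw [this, ← Function.iterate_mul, mul_comm, Function.iterate_mul]
    exact Function.iterate_fixed hp m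
  obtain ⟨l, hl⟩ := exists_int_of_coe_eq hfix
  have hl0 : (l : ℝ) = 0 := by
    have := hPhi n
    rw [hl, Phi_add_int a hb] at this
    linarith
  rw [hl0, add_zero] at hl
  rw [← hcoe, hmono.eq_of_iterate_eq hn hl]

theorem stmt7 (a : UnitAddCircle) (b : ℝ) (hb : b ∈ Set.Icc (0:ℝ) 1)
    (n : ℕ) (hn : 0 < n) (p : UnitAddCircle)
    (hp : (plpdm a b)^[n] p = p)
    (hmin : ∀ m, 0 < m → m < n → (plpdm a b)^[m] p ≠ p) :
    Dbl^[n] (phiMap a b p) = phiMap a b p ∧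
    ∀ m, 0 < m → m < n → Dbl^[m] (phiMap a b p) ≠ phiMap a b p := by
  have hsemi (m : ℕ) : phiMap a b ((plpdm a b)^[m] p) = Dbl^[m] (phiMap a b p) :=
    ((semiconj_phiMap a hb).iterate_right m) p
  refine ⟨by rw [← hsemi, hp], fun m hm hmn h => hmin m hm hmn ?_⟩
  exact plpdm_iterate_eq_of_phiMap_eq a hb hn hp ((hsemi m).trans h)
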